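/- arXiv:1007.3116 — 11 statements merged into one kernel-verified Lean document; each statement's English description precedes it below -/
import Mathlib

section
/- For every γ ∈ (0,1) and δ > 0, the four vectors e₁, e₂, e₃, e₄ form an S₀-orthonormal eigenbasis of 𝒜₀: for all i, j ∈ {1,2,3,4} one has 𝒜₀·eᵢ = cᵢ·eᵢ and eᵢ · (S₀·eⱼ) = 1 if i = j and 0 otherwise, where (c₁, c₂, c₃, c₄) = (c₊, −c₊, c₋, −c₋). -/
open Matrix

/-- The symmetrizer `S₀` of the Boussinesq/Boussinesq system. -/
noncomputable def S0 (γ δ : ℝ) : Matrix (Fin 4) (Fin 4) ℝ :=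
  !![γ, γ, 0, 0; γ, 1, 0, 0; 0, 0, γ, 0; 0, 0, 0, 1/δ]

/-- The matrix `𝒜₀` of the linearized Boussinesq/Boussinesq system. -/
noncomputable def A0 (γ δ : ℝ) : Matrix (Fin 4) (Fin 4) ℝ :=
  !![0, 0, 1, 0; 0, 0, 0, 1/δ; 1, 1, 0, 0; γ, 1, 0, 0]

/-- The fast wave speed `c₊`. -/
noncomputable def cPlus (γ δ : ℝ) : ℝ :=
  Real.sqrt ((1 + δ + Real.sqrt ((1 - δ)^2 + 4*γ*δ)) / (2*δ))

/-- The slow wave speed `c₋`. -/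
noncomputable def cMinus (γ δ : ℝ) : ℝ :=
  Real.sqrt ((1 + δ - Real.sqrt ((1 - δ)^2 + 4*γ*δ)) / (2*δ))

/-- The normalizing constant `Θ₊ = √(2δ(c₊²−c₋²)|c₊²−1|)`. -/
noncomputable def ThetaPlus (γ δ : ℝ) : ℝ :=
  Real.sqrt (2*δ*((cPlus γ δ)^2 - (cMinus γ δ)^2) * |(cPlus γ δ)^2 - 1|)

/-- The normalizing constant `Θ₋ = √(2δ(c₊²−c₋²)|c₋²−1|)`. -/
noncomputable def ThetaMinus (γ δ : ℝ) : ℝ :=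
  Real.sqrt (2*δ*((cPlus γ δ)^2 - (cMinus γ δ)^2) * |(cMinus γ δ)^2 - 1|)

/-- The four eigenvalues `(c₁, c₂, c₃, c₄) = (c₊, −c₊, c₋, −c₋)`. -/
noncomputable def cList (γ δ : ℝ) : Fin 4 → ℝ :=
  ![cPlus γ δ, -cPlus γ δ, cMinus γ δ, -cMinus γ δ]

/-- The four eigenvectors `e₁, e₂, e₃, e₄` of `𝒜₀`. -/
noncomputable def eVec (γ δ : ℝ) : Fin 4 → Fin 4 → ℝ :=
  ![(ThetaPlus γ δ)⁻¹ •
      ![1/cPlus γ δ, cPlus γ δ - 1/cPlus γ δ, 1, δ*(cPlus γ δ)^2 - δ],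
    (ThetaPlus γ δ)⁻¹ •
      ![-(1/cPlus γ δ), 1/cPlus γ δ - cPlus γ δ, 1, δ*(cPlus γ δ)^2 - δ],
    (ThetaMinus γ δ)⁻¹ •
      ![-(1/cMinus γ δ), 1/cMinus γ δ - cMinus γ δ, -1, δ - δ*(cMinus γ δ)^2],
    (ThetaMinus γ δ)⁻¹ •
      ![1/cMinus γ δ, cMinus γ δ - 1/cMinus γ δ, -1, δ - δ*(cMinus γ δ)^2]]

theorem speeds_aux (γ δ : ℝ) (hγ : γ ∈ Set.Ioo (0:ℝ) 1) (hδ : 0 < δ) :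
    0 < cPlus γ δ ∧ 0 < cMinus γ δ ∧ δ * ((cPlus γ δ)^2 + (cMinus γ δ)^2) = 1 + δ ∧
    δ * ((cPlus γ δ)^2 * (cMinus γ δ)^2) = 1 - γ ∧ 1 < (cPlus γ δ)^2 ∧ (cMinus γ δ)^2 < 1 := by
  obtain ⟨h0, h1⟩ := hγ
  have hgd : 0 < γ * δ := mul_pos h0 hδ
  have hgd' : 0 < (1 - γ) * δ := mul_pos (by linarith) hδ
  have hD : 0 ≤ (1 - δ)^2 + 4*γ*δ := by nlinarith [sq_nonneg (1 - δ)]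
  have hs := Real.sq_sqrt hD
  have hs0 := Real.sqrt_nonneg ((1 - δ)^2 + 4*γ*δ)
  unfold cPlus cMinus
  set s := Real.sqrt ((1 - δ)^2 + 4*γ*δ)
  have a1 : s < 1 + δ := by
    apply lt_of_pow_lt_pow_left₀ 2 (by linarith)
    nlinarith
  have a2 : 1 - δ < s := by
    by_contra! h
    nlinarith
  have a3 : δ - 1 < s := by
    by_contra! h
    nlinarith
  have hp : 0 < (1 + δ + s) / (2*δ) := by apply div_pos <;> linarith
  have hm : 0 < (1 + δ - s) / (2*δ) := by apply div_pos <;> linarith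
  rw [Real.sq_sqrt hp.le, Real.sq_sqrt hm.le]
  refine ⟨Real.sqrt_pos.2 hp, Real.sqrt_pos.2 hm, ?_, ?_, ?_, ?_⟩
  · field_simp; ring
  · field_simp; linear_combination -hs
  · rw [lt_div_iff₀ (by linarith)]; linarith
  · rw [div_lt_iff₀ (by linarith)]; linarith

/-- For every `γ ∈ (0,1)` and `δ > 0`, the four vectors `e₁, e₂, e₃, e₄` form an
`S₀`-orthonormal eigenbasis of `𝒜₀`: for all `i, j` one has `𝒜₀·eᵢ = cᵢ·eᵢ` and
`eᵢ · (S₀·eⱼ) = δᵢⱼ`. -/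
theorem eVec_orthonormal_eigenbasis (γ δ : ℝ) (hγ : γ ∈ Set.Ioo (0:ℝ) 1) (hδ : 0 < δ) :
    (∀ i : Fin 4, (A0 γ δ).mulVec (eVec γ δ i) = cList γ δ i • eVec γ δ i) ∧
    (∀ i j : Fin 4,
      eVec γ δ i ⬝ᵥ (S0 γ δ).mulVec (eVec γ δ j) = if i = j then 1 else 0) := by
  obtain ⟨hp, hq, hsum, hprod, hp1, hq1⟩ := speeds_aux γ δ hγ hδ
  have hTp : (ThetaPlus γ δ)^2
      = 2*δ*((cPlus γ δ)^2 - (cMinus γ δ)^2) * ((cPlus γ δ)^2 - 1) := by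
    unfold ThetaPlus
    rw [abs_of_pos (by linarith), Real.sq_sqrt]
    exact mul_nonneg (mul_nonneg (by linarith) (by linarith)) (by linarith)
  have hTm : (ThetaMinus γ δ)^2
      = 2*δ*((cPlus γ δ)^2 - (cMinus γ δ)^2) * (1 - (cMinus γ δ)^2) := by
    unfold ThetaMinus
    rw [abs_of_neg (by linarith), Real.sq_sqrt]
    · ring
    exact mul_nonneg (mul_nonneg (by linarith) (by linarith)) (by linarith)
  have hTp0 : ThetaPlus γ δ ≠ 0 := by
    intro h
    have : 0 < 2*δ*((cPlus γ δ)^2 - (cMinus γ δ)^2) * ((cPlus γ δ)^2 - 1) :=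
      mul_pos (mul_pos (by linarith) (by linarith)) (by linarith)
    rw [← hTp, h] at this
    norm_num at this
  have hTm0 : ThetaMinus γ δ ≠ 0 := by
    intro h
    have : 0 < 2*δ*((cPlus γ δ)^2 - (cMinus γ δ)^2) * (1 - (cMinus γ δ)^2) :=
      mul_pos (mul_pos (by linarith) (by linarith)) (by linarith)
    rw [← hTm, h] at this
    norm_num at this
  unfold eVec cList A0 S0
  generalize ThetaPlus γ δ = T at *
  generalize ThetaMinus γ δ = U at *
  generalize cPlus γ δ = p at *
  generalize cMinus γ δ = q at *
  obtain rfl : γ = 1 - δ * (p^2*q^2) := by linarith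
  have hw : p^2 + q^2 - 1 ≠ 0 := by
    intro h
    have : δ * (p^2+q^2-1) = 1 := by linarith
    rw [h] at this; norm_num at this
  obtain rfl : δ = 1 / (p^2 + q^2 - 1) := by field_simp; linarith
  have hp0 := hp.ne'
  have hq0 := hq.ne'
  clear hγ hsum hprod
  constructor
  · intro i
    fin_cases i <;> ext k <;> fin_cases k <;>
      simp [Matrix.mulVec, dotProduct, Fin.sum_univ_four] <;> field_simp <;> ring
  · intro i j
    fin_cases i <;> fin_cases j <;>
      simp [Matrix.mulVec, dotProduct, Fin.sum_univ_four] <;> field_simp <;>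
      first
      | ring1
      | (rw [hTp]; field_simp; ring1)
      | (rw [hTm]; field_simp; ring1)
end

section
/- For every γ ∈ (0,1), δ > 0, a₁ ∈ ℝ, a₂ ≥ 0, b₁ ≥ 0 and λ₁, λ₂, λ₃, λ₄ ∈ [0,1], the matrices S₂ = S₀·𝒜₂ + S̃₂ and Σ₂ = S₀·𝒜₁ + S̃₂·𝒜₀ are symmetric; moreover, for every K ∈ ℝ the matrices S₀·𝒜₂ + (S̃₂ + K·S₀) and S₀·𝒜₁ + (S̃₂ + K·S₀)·𝒜₀ are still symmetric, and there exists K₀ ∈ ℝ such that for all K ≥ K₀ the symmetric matrix S₀·𝒜₂ + S̃₂ + K·S₀ is positive definite. -/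
open Matrix

noncomputable def β₁ (b₁ : ℝ) : ℝ := 1/3 - b₁
noncomputable def α₁ (δ a₁ : ℝ) : ℝ := 1/(2*δ) - a₁
noncomputable def α₂ (δ a₂ : ℝ) : ℝ := 1/(3*δ^2) - a₂
noncomputable def β₂ (γ δ a₂ : ℝ) : ℝ := a₂ + γ/δ
noncomputable def aCoef (γ δ a₂ b₁ l₁ l₂ : ℝ) : ℝ :=
  γ*((1 - l₂)*α₂ δ a₂ - (1 - l₁)*β₁ b₁)
noncomputable def bCoef (γ δ a₁ l₂ : ℝ) : ℝ := γ*(1 - l₂)*α₁ δ a₁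

/-- The matrix `𝒜₁` of the three-parameter family of Boussinesq/Boussinesq systems. -/
noncomputable def A1 (γ δ a₁ a₂ b₁ l₁ l₂ l₃ l₄ : ℝ) : Matrix (Fin 4) (Fin 4) ℝ :=
  !![0, 0, -l₁*β₁ b₁, -l₂*α₁ δ a₁;
     0, 0, 0, -l₂*α₂ δ a₂/δ;
     -l₃*b₁ - l₄*γ*a₁, -l₃*b₁ - l₄*a₁, 0, 0;
     -l₄*γ*β₂ γ δ a₂ - l₃*γ/2, -l₄*β₂ γ δ a₂ - l₃*γ/2, 0, 0]

/-- The matrix `𝒜₂` of the three-parameter family of Boussinesq/Boussinesq systems. -/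
noncomputable def A2 (γ δ a₁ a₂ b₁ l₁ l₂ l₃ l₄ : ℝ) : Matrix (Fin 4) (Fin 4) ℝ :=
  !![(1 - l₁)*β₁ b₁, δ*(1 - l₂)*α₁ δ a₁, 0, 0;
     0, (1 - l₂)*α₂ δ a₂, 0, 0;
     0, 0, (1 - l₃)*b₁, (1 - l₄)*a₁;
     0, 0, (1 - l₃)*γ/2, (1 - l₄)*β₂ γ δ a₂]

/-- The matrix `S̃₂` completing the second-order symmetrizer. -/
noncomputable def St2 (γ δ a₁ a₂ b₁ l₁ l₂ l₃ l₄ : ℝ) : Matrix (Fin 4) (Fin 4) ℝ :=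
  !![aCoef γ δ a₂ b₁ l₁ l₂ + (δ - 1 + γ)*bCoef γ δ a₁ l₂, 0, 0, 0;
     aCoef γ δ a₂ b₁ l₁ l₂ + δ*bCoef γ δ a₁ l₂, 0, 0, 0;
     0, 0, aCoef γ δ a₂ b₁ l₁ l₂ + (δ - 1)*bCoef γ δ a₁ l₂ + γ*(b₁*l₃ - l₁*β₁ b₁),
       bCoef γ δ a₁ l₂ + γ*l₄*a₁;
     0, 0, γ*(l₃/(2*δ) - l₂*α₁ δ a₁), (l₄*β₂ γ δ a₂ - l₂*α₂ δ a₂)/δ]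

theorem quad_bound (M : Matrix (Fin 4) (Fin 4) ℝ) (x : Fin 4 → ℝ) :
    -((∑ i, ∑ j, |M i j|) * ∑ k, x k ^ 2) ≤ x ⬝ᵥ (M *ᵥ x) := by
  have e : x ⬝ᵥ (M *ᵥ x) = ∑ i, ∑ j, M i j * (x i * x j) := by
    simp only [dotProduct, mulVec, Finset.mul_sum]
    exact Finset.sum_congr rfl fun i _ => Finset.sum_congr rfl fun j _ => by ring
  rw [e, Finset.sum_mul, ← Finset.sum_neg_distrib]
  refine Finset.sum_le_sum fun i _ => ?_
  rw [Finset.sum_mul, ← Finset.sum_neg_distrib]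
  refine Finset.sum_le_sum fun j _ => ?_
  have hk : ∀ k, x k ^ 2 ≤ ∑ k, x k ^ 2 := fun k =>
    Finset.single_le_sum (f := fun k => x k ^ 2) (fun k _ => sq_nonneg (x k)) (Finset.mem_univ k)
  have h1 : |x i * x j| ≤ ∑ k, x k ^ 2 := by
    rw [abs_le]
    constructor
    · nlinarith [hk i, hk j, sq_nonneg (x i + x j)]
    · nlinarith [hk i, hk j, sq_nonneg (x i - x j)]
  have h2 := mul_le_mul_of_nonneg_left h1 (abs_nonneg (M i j))
  rw [← abs_mul] at h2
  linarith [neg_abs_le (M i j * (x i * x j))]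

theorem S0_bound (γ δ : ℝ) (h0 : 0 < γ) (h1 : γ < 1) (hδ : 0 < δ) (x : Fin 4 → ℝ) :
    ∑ k, x k ^ 2 ≤ (3/γ + 3/(1-γ) + δ) * (x ⬝ᵥ (S0 γ δ *ᵥ x)) := by
  have h1' : 0 < 1 - γ := by linarith
  have e : x ⬝ᵥ (S0 γ δ *ᵥ x)
      = γ*(x 0 + x 1)^2 + (1-γ)*(x 1)^2 + γ*(x 2)^2 + 1/δ*(x 3)^2 := by
    simp [S0, dotProduct, mulVec, Fin.sum_univ_four]
    ring
  rw [e, Fin.sum_univ_four]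
  have p1 : 0 ≤ γ*(x 0 + x 1)^2 := by positivity
  have p2 : 0 ≤ (1-γ)*(x 1)^2 := by positivity
  have p3 : 0 ≤ γ*(x 2)^2 := by positivity
  have p4 : 0 ≤ 1/δ*(x 3)^2 := by positivity
  have q1 : 3/γ * (γ*(x 0 + x 1)^2) = 3*(x 0 + x 1)^2 := by field_simp
  have q2 : 3/(1-γ) * ((1-γ)*(x 1)^2) = 3*(x 1)^2 := by field_simp
  have q3 : 3/γ * (γ*(x 2)^2) = 3*(x 2)^2 := by field_simp
  have q4 : δ * (1/δ*(x 3)^2) = (x 3)^2 := by field_simp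
  have a1 : 0 < 3/γ := by positivity
  have a2 : 0 < 3/(1-γ) := by positivity
  generalize γ*(x 0 + x 1)^2 = P1 at *
  generalize (1-γ)*(x 1)^2 = P2 at *
  generalize γ*(x 2)^2 = P3 at *
  generalize 1/δ*(x 3)^2 = P4 at *
  generalize 3/γ = c1 at *
  generalize 3/(1-γ) = c2 at *
  have := mul_nonneg a1.le p2
  have := mul_nonneg a1.le p4
  have := mul_nonneg a2.le p1
  have := mul_nonneg a2.le p3
  have := mul_nonneg a2.le p4
  have := mul_nonneg hδ.le p1
  have := mul_nonneg hδ.le p2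
  have := mul_nonneg hδ.le p3
  nlinarith [sq_nonneg (x 0 + 2 * x 1), sq_nonneg (x 2), sq_nonneg (x 0 + x 1), sq_nonneg (x 1)]

theorem posDef_large (γ δ : ℝ) (h0 : 0 < γ) (h1 : γ < 1) (hδ : 0 < δ)
    (M : Matrix (Fin 4) (Fin 4) ℝ) (hs : ∀ K : ℝ, (M + K • S0 γ δ).IsSymm) :
    ∃ K₀ : ℝ, ∀ K ≥ K₀, (M + K • S0 γ δ).PosDef := by
  have h1' : 0 < 1 - γ := by linarith
  refine ⟨((∑ i, ∑ j, |M i j|) + 1) * (3/γ + 3/(1-γ) + δ), fun K hK => ?_⟩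
  refine Matrix.PosDef.of_dotProduct_mulVec_pos ?_ ?_
  · rw [Matrix.IsHermitian, conjTranspose_eq_transpose_of_trivial]
    exact hs K
  · intro x hx
    have hpos : 0 < ∑ k, x k ^ 2 := by
      obtain ⟨k, hk⟩ := Function.ne_iff.mp hx
      exact Finset.sum_pos' (fun k _ => sq_nonneg (x k)) ⟨k, Finset.mem_univ k, by
        have : x k ≠ 0 := hk
        positivity⟩
    rw [star_trivial, add_mulVec, dotProduct_add, smul_mulVec, dotProduct_smul, smul_eq_mul]
    have b1 := quad_bound M x
    have b2 := S0_bound γ δ h0 h1 hδ x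
    have hC : 0 ≤ ∑ i, ∑ j, |M i j| :=
      Finset.sum_nonneg fun i _ => Finset.sum_nonneg fun j _ => abs_nonneg _
    have hD : 0 < 3/γ + 3/(1-γ) + δ := by positivity
    generalize (∑ i, ∑ j, |M i j|) = C at *
    generalize 3/γ + 3/(1-γ) + δ = D at *
    have hS : 0 < x ⬝ᵥ (S0 γ δ *ᵥ x) := by
      by_contra hn
      push Not at hn
      nlinarith
    have b3 := mul_le_mul_of_nonneg_right hK hS.le
    have b4 := mul_le_mul_of_nonneg_left b2 (by linarith : 0 ≤ C + 1)
    nlinarith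

theorem symm_A2 (γ δ a₁ a₂ b₁ l₁ l₂ l₃ l₄ K : ℝ) (hδ : δ ≠ 0) :
    (S0 γ δ * A2 γ δ a₁ a₂ b₁ l₁ l₂ l₃ l₄
        + (St2 γ δ a₁ a₂ b₁ l₁ l₂ l₃ l₄ + K • S0 γ δ)).IsSymm := by
  refine Matrix.IsSymm.ext fun i j => ?_
  fin_cases i <;> fin_cases j <;>
    simp [S0, A2, St2, Matrix.mul_apply, Fin.sum_univ_four, aCoef, bCoef, α₁, α₂, β₁, β₂] <;>
    field_simp <;> ring

theorem symm_A1 (γ δ a₁ a₂ b₁ l₁ l₂ l₃ l₄ K : ℝ) (hδ : δ ≠ 0) :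
    (S0 γ δ * A1 γ δ a₁ a₂ b₁ l₁ l₂ l₃ l₄
        + (St2 γ δ a₁ a₂ b₁ l₁ l₂ l₃ l₄ + K • S0 γ δ) * A0 γ δ).IsSymm := by
  refine Matrix.IsSymm.ext fun i j => ?_
  fin_cases i <;> fin_cases j <;>
    simp [S0, A0, A1, St2, Matrix.mul_apply, Fin.sum_univ_four, aCoef, bCoef, α₁, α₂, β₁, β₂] <;>
    field_simp <;> ring

/-- For every `γ ∈ (0,1)`, `δ > 0`, `a₁ ∈ ℝ`, `a₂ ≥ 0`, `b₁ ≥ 0` and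
`λ₁, λ₂, λ₃, λ₄ ∈ [0,1]`, the matrices `S₂ = S₀·𝒜₂ + S̃₂` and `Σ₂ = S₀·𝒜₁ + S̃₂·𝒜₀`
are symmetric; moreover, for every `K ∈ ℝ` the matrices `S₀·𝒜₂ + (S̃₂ + K·S₀)` and
`S₀·𝒜₁ + (S̃₂ + K·S₀)·𝒜₀` are still symmetric, and there exists `K₀ ∈ ℝ` such that for
all `K ≥ K₀` the symmetric matrix `S₀·𝒜₂ + S̃₂ + K·S₀` is positive definite. -/
theorem second_order_symmetrizer (γ δ a₁ a₂ b₁ l₁ l₂ l₃ l₄ : ℝ)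
    (hγ : γ ∈ Set.Ioo (0:ℝ) 1) (hδ : 0 < δ) (ha₂ : 0 ≤ a₂) (hb₁ : 0 ≤ b₁)
    (hl₁ : l₁ ∈ Set.Icc (0:ℝ) 1) (hl₂ : l₂ ∈ Set.Icc (0:ℝ) 1)
    (hl₃ : l₃ ∈ Set.Icc (0:ℝ) 1) (hl₄ : l₄ ∈ Set.Icc (0:ℝ) 1) :
    (S0 γ δ * A2 γ δ a₁ a₂ b₁ l₁ l₂ l₃ l₄ + St2 γ δ a₁ a₂ b₁ l₁ l₂ l₃ l₄).IsSymm ∧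
    (S0 γ δ * A1 γ δ a₁ a₂ b₁ l₁ l₂ l₃ l₄
      + St2 γ δ a₁ a₂ b₁ l₁ l₂ l₃ l₄ * A0 γ δ).IsSymm ∧
    (∀ K : ℝ,
      (S0 γ δ * A2 γ δ a₁ a₂ b₁ l₁ l₂ l₃ l₄
        + (St2 γ δ a₁ a₂ b₁ l₁ l₂ l₃ l₄ + K • S0 γ δ)).IsSymm ∧
      (S0 γ δ * A1 γ δ a₁ a₂ b₁ l₁ l₂ l₃ l₄
        + (St2 γ δ a₁ a₂ b₁ l₁ l₂ l₃ l₄ + K • S0 γ δ) * A0 γ δ).IsSymm) ∧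
    ∃ K₀ : ℝ, ∀ K ≥ K₀,
      (S0 γ δ * A2 γ δ a₁ a₂ b₁ l₁ l₂ l₃ l₄
        + St2 γ δ a₁ a₂ b₁ l₁ l₂ l₃ l₄ + K • S0 γ δ).PosDef := by
  have hne := hδ.ne'
  refine ⟨?_, ?_, fun K => ⟨symm_A2 _ _ _ _ _ _ _ _ _ K hne, symm_A1 _ _ _ _ _ _ _ _ _ K hne⟩, ?_⟩
  · simpa using symm_A2 γ δ a₁ a₂ b₁ l₁ l₂ l₃ l₄ 0 hne
  · simpa using symm_A1 γ δ a₁ a₂ b₁ l₁ l₂ l₃ l₄ 0 hne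
  · refine posDef_large γ δ hγ.1 hγ.2 hδ _ fun K => ?_
    rw [add_assoc]
    exact symm_A2 _ _ _ _ _ _ _ _ _ K hne
end

section
/- Let c, x₀, ε, M, λ, μ be real numbers with μ ≠ 0 and λM/μ > 0. Set k = √(λM/(12μ)), c' = c + ελM/3, and define u : ℝ × ℝ → ℝ by u(t,x) = M / cosh²(k(x − x₀ − c't)). Then u is a solitary-wave solution of the Korteweg–de Vries equation: for all (t,x) ∈ ℝ², ∂ₜu(t,x) + c·∂ₓu(t,x) + ελ·u(t,x)·∂ₓu(t,x) + εμ·∂ₓ³u(t,x) = 0, where ∂ₜ denotes the derivative in the first variable and ∂ₓ, ∂ₓ³ denote the first and third derivatives in the second variable. -/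
theorem kdv_d0 (A z : ℝ) : HasDerivAt (fun z => A / Real.cosh z ^ 2)
    (-2 * A * (Real.sinh z / Real.cosh z ^ 3)) z := by
  have hC := (Real.cosh_pos z).ne'
  refine ((hasDerivAt_const z A).fun_div ((Real.hasDerivAt_cosh z).fun_pow 2)
    (pow_ne_zero 2 hC)).congr_deriv ?_
  field_simp
  ring

theorem kdv_d1 (A z : ℝ) : HasDerivAt (fun z => A * (Real.sinh z / Real.cosh z ^ 3))
    (A * (3 / Real.cosh z ^ 4 - 2 / Real.cosh z ^ 2)) z := by
  have hC := (Real.cosh_pos z).ne'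
  refine (((Real.hasDerivAt_sinh z).fun_div ((Real.hasDerivAt_cosh z).fun_pow 3)
    (pow_ne_zero 3 hC)).const_mul A).congr_deriv ?_
  have hs := Real.sinh_sq z
  congr 1
  field_simp
  simp only [hs]
  push_cast
  ring_nf
  try simp only [hs]
  try ring

theorem kdv_d2 (A z : ℝ) : HasDerivAt (fun z => A * (4 / Real.cosh z ^ 2 - 6 / Real.cosh z ^ 4))
    (A * (-8 * Real.sinh z / Real.cosh z ^ 3 + 24 * Real.sinh z / Real.cosh z ^ 5)) z := by
  have hC := (Real.cosh_pos z).ne'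
  refine ((((hasDerivAt_const z (4:ℝ)).fun_div ((Real.hasDerivAt_cosh z).fun_pow 2)
    (pow_ne_zero 2 hC)).fun_sub ((hasDerivAt_const z (6:ℝ)).fun_div
    ((Real.hasDerivAt_cosh z).fun_pow 4) (pow_ne_zero 4 hC))).const_mul A).congr_deriv ?_
  congr 1
  field_simp
  ring

/-- Let `c, x₀, ε, M, λ, μ` be real numbers with `μ ≠ 0` and `λM/μ > 0`. Set
`k = √(λM/(12μ))`, `c' = c + ελM/3`, and `u(t,x) = M / cosh²(k(x − x₀ − c't))`. Then `u`
is a solitary-wave solution of the Korteweg–de Vries equation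
`∂ₜu + c·∂ₓu + ελ·u·∂ₓu + εμ·∂ₓ³u = 0`. -/
theorem kdv_solitary_wave (c x₀ ε M lam μ : ℝ) (hμ : μ ≠ 0) (h : lam * M / μ > 0)
    (k c' : ℝ) (hk : k = Real.sqrt (lam * M / (12 * μ))) (hc' : c' = c + ε * lam * M / 3)
    (u : ℝ → ℝ → ℝ)
    (hu : ∀ t x, u t x = M / (Real.cosh (k * (x - x₀ - c' * t)))^2) :
    ∀ t x : ℝ,
      deriv (fun s => u s x) t
        + c * deriv (fun y => u t y) x
        + ε * lam * u t x * deriv (fun y => u t y) x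
        + ε * μ * (deriv^[3] (fun y => u t y) x) = 0 := by
  intro t x
  have hk2 : μ * k ^ 2 = lam * M / 12 := by
    have h0 : 0 ≤ lam * M / (12 * μ) := by
      have : lam * M / (12 * μ) = (lam * M / μ) / 12 := by field_simp
      rw [this]; positivity
    rw [hk, Real.sq_sqrt h0]; field_simp
  have hC : ∀ z, Real.cosh z ≠ 0 := fun z => (Real.cosh_pos z).ne'
  have hx : ∀ y, HasDerivAt (fun y => k * (y - x₀ - c' * t)) k y := fun y => by
    simpa using (((hasDerivAt_id y).sub_const x₀).sub_const (c' * t)).const_mul k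
  have ht : HasDerivAt (fun s => k * (x - x₀ - c' * s)) (-(k * c')) t := by
    simpa using (((hasDerivAt_id t).const_mul c').const_sub (x - x₀)).const_mul k
  have e0 : (fun y => u t y) = fun y => M / Real.cosh (k * (y - x₀ - c' * t)) ^ 2 :=
    funext fun y => hu t y
  have et : (fun s => u s x) = fun s => M / Real.cosh (k * (x - x₀ - c' * s)) ^ 2 :=
    funext fun s => hu s x
  have d0 := kdv_d0 M
  have d1 := kdv_d1 (-2 * k * M)
  have d2 := kdv_d2 (k ^ 2 * M)
  have E1 : deriv (fun y => u t y) = fun y => -2 * k * M * (Real.sinh (k * (y - x₀ - c' * t)) / Real.cosh (k * (y - x₀ - c' * t)) ^ 3) := by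
    rw [e0]; funext y
    refine Eq.trans ((d0 _).comp y (hx y) : HasDerivAt (fun y => M / Real.cosh (k * (y - x₀ - c' * t)) ^ 2) _ y).deriv ?_
    ring
  have E2 : deriv (deriv (fun y => u t y)) = fun y => k ^ 2 * M * (4 / Real.cosh (k * (y - x₀ - c' * t)) ^ 2 - 6 / Real.cosh (k * (y - x₀ - c' * t)) ^ 4) := by
    rw [E1]; funext y
    refine Eq.trans ((d1 _).comp y (hx y) : HasDerivAt (fun y => -2 * k * M * (Real.sinh (k * (y - x₀ - c' * t)) / Real.cosh (k * (y - x₀ - c' * t)) ^ 3)) _ y).deriv ?_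
    ring
  have E3 : deriv^[3] (fun y => u t y) x = k ^ 2 * M * (-8 * Real.sinh (k * (x - x₀ - c' * t)) / Real.cosh (k * (x - x₀ - c' * t)) ^ 3 + 24 * Real.sinh (k * (x - x₀ - c' * t)) / Real.cosh (k * (x - x₀ - c' * t)) ^ 5) * k := by
    change deriv (deriv (deriv (fun y => u t y))) x = _
    rw [E2]
    exact ((d2 _).comp x (hx x) : HasDerivAt (fun y => k ^ 2 * M * (4 / Real.cosh (k * (y - x₀ - c' * t)) ^ 2 - 6 / Real.cosh (k * (y - x₀ - c' * t)) ^ 4)) _ x).deriv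
  have Et : deriv (fun s => u s x) t = -2 * M * (Real.sinh (k * (x - x₀ - c' * t)) / Real.cosh (k * (x - x₀ - c' * t)) ^ 3) * (-(k * c')) := by
    rw [et]
    exact ((d0 _).comp t ht : HasDerivAt (fun s => M / Real.cosh (k * (x - x₀ - c' * s)) ^ 2) _ t).deriv
  rw [E3, Et, E1, hu, hc']
  beta_reduce
  have hCC := hC (k * (x - x₀ - (c + ε * lam * M / 3) * t))
  generalize Real.cosh (k * (x - x₀ - (c + ε * lam * M / 3) * t)) = C at *
  generalize Real.sinh (k * (x - x₀ - (c + ε * lam * M / 3) * t)) = S at *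
  have key : ∀ D : ℝ, ε * μ * (k ^ 2 * M * D * k) = ε * (lam * M / 12) * (M * D * k) := by
    intro D; rw [← hk2]; ring
  rw [key]
  field_simp
  ring
end

section
/- For every γ ∈ (0,1), the cubic polynomial P(X) = X³ + (γ²+3γ−3)X² + (3−4γ)X − 1 has exactly one real root δ_c, and this root satisfies 1 < δ_c ≤ 5/4. -/
/-- For every `γ ∈ (0,1)`, the cubic polynomial
`P(X) = X³ + (γ²+3γ−3)X² + (3−4γ)X − 1` has exactly one real root `δ_c`, and this root
satisfies `1 < δ_c ≤ 5/4`. -/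
theorem critical_ratio_exists_unique (γ : ℝ) (hγ : γ ∈ Set.Ioo (0:ℝ) 1) :
    ∃ δc : ℝ,
      (δc^3 + (γ^2 + 3*γ - 3)*δc^2 + (3 - 4*γ)*δc - 1 = 0 ∧ 1 < δc ∧ δc ≤ 5/4) ∧
      ∀ x : ℝ, x^3 + (γ^2 + 3*γ - 3)*x^2 + (3 - 4*γ)*x - 1 = 0 → x = δc := by
  obtain ⟨h0, h1⟩ := hγ
  have key : ∀ x : ℝ, x^3 + (γ^2 + 3*γ - 3)*x^2 + (3 - 4*γ)*x - 1 = 0 → 1 < x := by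
    intro x hx
    by_contra hle
    have hle : 0 ≤ 1 - x := by linarith [not_lt.mp hle]
    have hg : 0 < 1 - γ := by linarith
    have e : (1-γ)*(1-x)^3 + γ*((x+1)^2*(1-x)) + γ*(1-γ)*x^2 = 0 := by
      linear_combination -hx
    have a1 : 0 ≤ (1-γ)*(1-x)^3 := by positivity
    have a2 : 0 ≤ γ*((x+1)^2*(1-x)) := by positivity
    rcases eq_or_ne x 0 with h | h
    · subst h
      norm_num at hx
    · have a3 : 0 < γ*(1-γ)*x^2 := by positivity
      linarith
  have ex : ∃ r ∈ Set.Icc (1:ℝ) (5/4),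
      r^3 + (γ^2 + 3*γ - 3)*r^2 + (3 - 4*γ)*r - 1 = 0 := by
    have hc : ContinuousOn (fun r : ℝ => r^3 + (γ^2 + 3*γ - 3)*r^2 + (3 - 4*γ)*r - 1)
        (Set.Icc (1:ℝ) (5/4)) := by fun_prop
    have := intermediate_value_Icc (by norm_num : (1:ℝ) ≤ 5/4) hc
    obtain ⟨r, hr, h⟩ := this (show (0:ℝ) ∈ Set.Icc _ _ from
      ⟨by nlinarith [mul_pos h0 (sub_pos.mpr h1)], by nlinarith [sq_nonneg (10*γ-1)]⟩)
    exact ⟨r, hr, h⟩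
  obtain ⟨r, hr, hP⟩ := ex
  refine ⟨r, ⟨hP, key r hP, hr.2⟩, ?_⟩
  intro s hs
  by_contra hne
  have hr1 := key r hP
  have hs1 := key s hs
  have hQ : s^2 + r*s + r^2 + (γ^2 + 3*γ - 3)*(r+s) + (3 - 4*γ) = 0 := by
    apply mul_left_cancel₀ (sub_ne_zero.mpr hne)
    linear_combination hs - hP
  obtain ⟨t, ht⟩ : ∃ t, t = -(γ^2 + 3*γ - 3) - r - s := ⟨_, rfl⟩
  have ht1 : 1 < t := by
    apply key
    subst ht
    linear_combination hP + (-(γ^2 + 3*γ - 3) - r - s - r) * hQ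
  have hprod : r*s*t = 1 := by
    subst ht
    linear_combination hP - r * hQ
  have : 1 < r*s := by nlinarith
  nlinarith
end

section
/- Let γ ∈ (0,1) and let δ_c be a real root of the polynomial X³ + (γ²+3γ−3)X² + (3−4γ)X − 1. Then for every δ > 0, the slow-mode nonlinearity N₋(γ,δ) = (2−δ)·c₋² + δ − 1/δ − (1−γ) is positive if and only if δ > δ_c. -/
/-- Let `γ ∈ (0,1)` and let `δ_c` be a real root of
`X³ + (γ²+3γ−3)X² + (3−4γ)X − 1`. Then for every `δ > 0`, the slow-mode nonlinearity
`N₋(γ,δ) = (2−δ)c₋² + δ − 1/δ − (1−γ)` is positive if and only if `δ > δ_c`. -/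
theorem slow_mode_nonlinearity_sign (γ δc : ℝ) (hγ : γ ∈ Set.Ioo (0:ℝ) 1)
    (hδc : δc^3 + (γ^2 + 3*γ - 3)*δc^2 + (3 - 4*γ)*δc - 1 = 0) :
    ∀ δ : ℝ, 0 < δ →
      (0 < (2 - δ)*(cMinus γ δ)^2 + δ - 1/δ - (1 - γ) ↔ δ > δc) := by
  intro δ hδ
  obtain ⟨h0, h1⟩ := hγ
  have hg : 0 < γ * (1 - γ) := mul_pos h0 (by linarith)
  have key : ∀ x : ℝ, x ^ 3 + (γ^2 + 3*γ - 3)*x^2 + (3 - 4*γ)*x - 1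
      = (x - 1) * (x - 1 + 2*γ)^2 - γ * (1 - γ) * (2 - x)^2 := by intro x; ring
  have pos : ∀ x : ℝ, 0 ≤ x ^ 3 + (γ^2 + 3*γ - 3)*x^2 + (3 - 4*γ)*x - 1 → 1 < x := by
    intro x hx
    by_contra hc
    push Not at hc
    rw [key] at hx
    have e1 : 0 ≤ (1 - x) * (x - 1 + 2*γ)^2 := mul_nonneg (by linarith) (sq_nonneg _)
    have e2 : 0 < γ * (1 - γ) * (2 - x)^2 := mul_pos hg (pow_pos (by linarith) 2)
    linarith
  have hc1 := pos δc hδc.ge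
  have hdiff : ∀ x : ℝ, x ^ 3 + (γ^2 + 3*γ - 3)*x^2 + (3 - 4*γ)*x - 1
      = (x - δc) * ((x-1)^2 + (x-1)*(δc-1) + (δc-1)^2 + (γ^2+3*γ)*((x-1)+(δc-1))
        + (2*γ^2+2*γ)) := by
    intro x
    linear_combination hδc
  have hP : 0 < δ ^ 3 + (γ^2 + 3*γ - 3)*δ^2 + (3 - 4*γ)*δ - 1 ↔ δ > δc := by
    constructor
    · intro h
      have hx := pos δ h.le
      rw [hdiff] at h
      have a1 : 0 < δ - 1 := by linarith
      have a2 : 0 < δc - 1 := by linarith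
      have := pos_of_mul_pos_left h (by positivity)
      linarith
    · intro h
      rw [hdiff]
      have a0 : 0 < δ - δc := by linarith
      have a1 : 0 < δ - 1 := by linarith
      have a2 : 0 < δc - 1 := by linarith
      positivity
  rw [← hP]
  have hr : 0 ≤ (1 - δ)^2 + 4*γ*δ := by positivity
  obtain ⟨S, hS⟩ : ∃ S, S = Real.sqrt ((1 - δ)^2 + 4*γ*δ) := ⟨_, rfl⟩
  have hS0 : 0 ≤ S := hS ▸ Real.sqrt_nonneg _
  have hS2 : S ^ 2 = (1 - δ)^2 + 4*γ*δ := by rw [hS]; exact Real.sq_sqrt hr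
  have hSp : 0 < S := by
    have : 0 < S ^ 2 := by rw [hS2]; positivity
    exact lt_of_le_of_ne hS0 (by rintro rfl; norm_num at this)
  have hSle : S ≤ 1 + δ := by
    apply (sq_le_sq₀ hS0 (by linarith)).1
    nlinarith [mul_pos hδ (sub_pos.2 h1)]
  have hc2 : (cMinus γ δ)^2 = (1 + δ - S) / (2*δ) := by
    unfold cMinus
    rw [← hS]
    exact Real.sq_sqrt (div_nonneg (by linarith) (by linarith))
  have hN : (2 - δ)*(cMinus γ δ)^2 + δ - 1/δ - (1 - γ)
      = (δ * (δ - 1 + 2*γ) - (2 - δ) * S) / (2*δ) := by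
    rw [hc2]; field_simp; ring
  have hQ : (δ * (δ - 1 + 2*γ))^2 - ((2 - δ) * S)^2
      = 4 * (δ ^ 3 + (γ^2 + 3*γ - 3)*δ^2 + (3 - 4*γ)*δ - 1) := by
    rw [mul_pow (2 - δ) S, hS2]; ring
  rw [hN, div_pos_iff_of_pos_right (by linarith)]
  constructor
  · intro h
    rcases lt_or_ge δ 2 with h2 | h2
    · have hB : 0 < (2 - δ) * S := mul_pos (by linarith) hSp
      have := mul_pos h (show 0 < δ * (δ - 1 + 2*γ) + (2 - δ) * S by linarith)
      linarith [this, hQ, sq_sub_sq (δ * (δ - 1 + 2*γ)) ((2 - δ) * S),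
        mul_comm (δ * (δ - 1 + 2*γ) - (2 - δ) * S) (δ * (δ - 1 + 2*γ) + (2 - δ) * S)]
    · rw [key]
      have c1 : 0 ≤ 1 - γ * (1 - γ) := by linarith [mul_pos h0 h0, mul_sub γ 1 γ]
      have c2 : (δ - 2)^2 < (δ - 1 + 2*γ)^2 :=
        pow_lt_pow_left₀ (by linarith) (by linarith) (by norm_num)
      have c3 := mul_nonneg c1 (sq_nonneg (δ - 2))
      have c4 := mul_nonneg (sub_nonneg.2 h2) (sq_nonneg (δ - 1 + 2*γ))
      linarith
  · intro h
    have hx := pos δ h.le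
    have hA : 0 < δ * (δ - 1 + 2*γ) := mul_pos hδ (by linarith)
    have := lt_of_pow_lt_pow_left₀ 2 hA.le (show ((2 - δ) * S)^2 < _ by linarith)
    linarith
end

section
/- For every γ ∈ (0,1) and δ > 0, one has c₋² ≥ 1/2 if and only if δ ≤ 2(1−2γ). Consequently, the amplitude of the surface deformation of the slow-mode wave, which is c₋²/(1−c₋²) times the amplitude of its interface deformation, is at least the interface amplitude exactly when 0 < δ ≤ 2(1−2γ). -/
/-- For every `γ ∈ (0,1)` and `δ > 0`, one has `c₋² ≥ 1/2` if and only if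
`δ ≤ 2(1−2γ)`. Consequently, the amplitude of the surface deformation of the slow-mode
wave, which is `c₋²/(1−c₋²)` times the amplitude of its interface deformation, is at
least the interface amplitude exactly when `0 < δ ≤ 2(1−2γ)`. -/
theorem slow_mode_surface_vs_interface (γ δ : ℝ) (hγ : γ ∈ Set.Ioo (0:ℝ) 1)
    (hδ : 0 < δ) :
    ((cMinus γ δ)^2 ≥ 1/2 ↔ δ ≤ 2*(1 - 2*γ)) ∧
    ((cMinus γ δ)^2 / (1 - (cMinus γ δ)^2) ≥ 1 ↔ δ ≤ 2*(1 - 2*γ)) := by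
  obtain ⟨hγ0, hγ1⟩ := hγ
  have hp : 0 < γ * δ := mul_pos hγ0 hδ
  have hq : 0 < (1 - γ) * δ := mul_pos (by linarith) hδ
  have hA : 0 ≤ (1 - δ)^2 + 4*γ*δ := by nlinarith [sq_nonneg (1 - δ)]
  have hs1 : Real.sqrt ((1 - δ)^2 + 4*γ*δ) ≤ 1 + δ :=
    Real.sqrt_le_iff.mpr ⟨by linarith, by nlinarith⟩
  have hs2 : 1 - δ < Real.sqrt ((1 - δ)^2 + 4*γ*δ) :=
    Real.lt_sqrt_of_sq_lt (by nlinarith)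
  have hc : (cMinus γ δ)^2 = (1 + δ - Real.sqrt ((1 - δ)^2 + 4*γ*δ)) / (2*δ) := by
    unfold cMinus
    exact Real.sq_sqrt (div_nonneg (by linarith) (by linarith))
  have hlt : (cMinus γ δ)^2 < 1 := by
    rw [hc, div_lt_one (by linarith)]
    linarith
  have h1 : (cMinus γ δ)^2 ≥ 1/2 ↔ δ ≤ 2*(1 - 2*γ) := by
    rw [hc, ge_iff_le, le_div_iff₀ (by linarith)]
    have e : Real.sqrt ((1 - δ)^2 + 4*γ*δ) ≤ 1 ↔ δ ≤ 2*(1 - 2*γ) := by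
      rw [Real.sqrt_le_iff, and_iff_right (zero_le_one' ℝ)]
      constructor
      · intro h
        by_contra hn
        push Not at hn
        nlinarith [mul_pos hδ (sub_pos.mpr hn)]
      · intro h
        nlinarith [mul_nonneg hδ.le (sub_nonneg.mpr h)]
    rw [← e]
    constructor <;> intro h <;> linarith
  refine ⟨h1, ?_⟩
  rw [← h1, ge_iff_le, le_div_iff₀ (by linarith)]
  constructor <;> intro h <;> linarith
end

section
/- For every γ ∈ (0,1) and δ > 0, one has (c₊² − 1)/c₊² ≥ (1 − c₋²)/c₋² if and only if δ ≤ 1 − 2γ. Consequently, for initial data with zero velocities and flat surface, the fast-mode interface waves are at least as large as the slow-mode interface waves exactly when δ ≤ 1 − 2γ. -/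
/-- For every `γ ∈ (0,1)` and `δ > 0`, one has `(c₊² − 1)/c₊² ≥ (1 − c₋²)/c₋²` if and
only if `δ ≤ 1 − 2γ`: for initial data with zero velocities and flat surface, the
fast-mode interface waves are at least as large as the slow-mode interface waves
exactly when `δ ≤ 1 − 2γ`. -/
theorem fast_vs_slow_interface_magnitude (γ δ : ℝ) (hγ : γ ∈ Set.Ioo (0:ℝ) 1)
    (hδ : 0 < δ) :
    ((cPlus γ δ)^2 - 1) / (cPlus γ δ)^2 ≥ (1 - (cMinus γ δ)^2) / (cMinus γ δ)^2 ↔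
      δ ≤ 1 - 2*γ := by
  obtain ⟨h0, h1⟩ := hγ
  have hD : 0 ≤ (1 - δ)^2 + 4*γ*δ := by positivity
  have hs0 := Real.sqrt_nonneg ((1 - δ)^2 + 4*γ*δ)
  have hs := Real.sq_sqrt hD
  unfold cPlus cMinus
  generalize Real.sqrt ((1 - δ)^2 + 4*γ*δ) = s at hs0 hs ⊢
  have hlt : s < 1 + δ := by
    have : 0 < (1 - γ) * δ := mul_pos (by linarith) hδ
    nlinarith
  have hp : 0 < (1 + δ + s) / (2*δ) := by positivity
  have hm : 0 < (1 + δ - s) / (2*δ) := div_pos (by linarith) (by positivity)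
  rw [Real.sq_sqrt hp.le, Real.sq_sqrt hm.le]
  have hsum : (1 + δ + s) / (2*δ) + (1 + δ - s) / (2*δ) = (1 + δ) / δ := by
    field_simp
    ring
  have hprod : (1 + δ + s) / (2*δ) * ((1 + δ - s) / (2*δ)) = (1 - γ) / δ := by
    field_simp
    linear_combination -hs
  generalize (1 + δ + s) / (2*δ) = p at *
  generalize (1 + δ - s) / (2*δ) = m at *
  have e1 : (1 - m) / m ≤ (p - 1) / p ↔ p + m ≤ 2 * (p * m) := by
    rw [div_le_div_iff₀ hm hp]
    constructor <;> intro h <;> linarith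
  rw [ge_iff_le, e1, hsum, hprod, ← mul_div_assoc, div_le_div_iff_of_pos_right hδ]
  constructor <;> intro h <;> linarith
end

section
/- For every γ ∈ (0,1) and δ > 0, the fast-mode nonlinear coefficients are positive: λⁱ₊ = (3c₊/2)·[(2−δ)c₊² + δ − 1/δ − (1−γ)] / |(c₊²−c₋²)(1−c₊²)| > 0 and λˢ₊ = (3c₊/2)·[(2−δ)c₊² + δ − 1/δ − (1−γ)] / ((c₊²−c₋²)·c₊²) > 0. -/
/-- For every `γ ∈ (0,1)` and `δ > 0`, the fast-mode nonlinear coefficients are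
positive:
`λⁱ₊ = (3c₊/2)·[(2−δ)c₊² + δ − 1/δ − (1−γ)] / |(c₊²−c₋²)(1−c₊²)| > 0` and
`λˢ₊ = (3c₊/2)·[(2−δ)c₊² + δ − 1/δ − (1−γ)] / ((c₊²−c₋²)·c₊²) > 0`. -/
theorem fast_mode_nonlinearity_pos (γ δ : ℝ) (hγ : γ ∈ Set.Ioo (0:ℝ) 1) (hδ : 0 < δ) :
    0 < (3*cPlus γ δ/2) * ((2 - δ)*(cPlus γ δ)^2 + δ - 1/δ - (1 - γ)) /
        |((cPlus γ δ)^2 - (cMinus γ δ)^2) * (1 - (cPlus γ δ)^2)| ∧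
    0 < (3*cPlus γ δ/2) * ((2 - δ)*(cPlus γ δ)^2 + δ - 1/δ - (1 - γ)) /
        (((cPlus γ δ)^2 - (cMinus γ δ)^2) * (cPlus γ δ)^2) := by
  obtain ⟨h0, h1⟩ := hγ
  have hgd : 0 < γ * δ := mul_pos h0 hδ
  have hgd' : 0 < (1 - γ) * δ := mul_pos (by linarith) hδ
  have hD : 0 ≤ (1 - δ)^2 + 4*γ*δ := by nlinarith [sq_nonneg (1 - δ)]
  have hR0 := Real.sqrt_nonneg ((1 - δ)^2 + 4*γ*δ)
  have hRsq := Real.sq_sqrt hD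
  unfold cPlus cMinus
  set R := Real.sqrt ((1 - δ)^2 + 4*γ*δ) with hR
  have hRa : |1 - δ| < R := abs_lt_of_sq_lt_sq (by nlinarith) hR0
  obtain ⟨hR1, hR2⟩ := abs_lt.mp hRa
  have hR3 : R < 1 + δ := by nlinarith
  have hRpos : 0 < R := lt_of_le_of_lt (abs_nonneg _) hRa
  have hp : 0 < (1 + δ + R) / (2*δ) := by positivity
  have hm : 0 ≤ (1 + δ - R) / (2*δ) := div_nonneg (by linarith) (by linarith)
  rw [Real.sq_sqrt hp.le, Real.sq_sqrt hm]
  have hc := Real.sqrt_pos.mpr hp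
  have hx1 : 1 < (1 + δ + R) / (2*δ) := by
    rw [lt_div_iff₀ (by positivity)]; linarith
  have hd : 0 < (1 + δ + R) / (2*δ) - (1 + δ - R) / (2*δ) := by
    rw [← sub_div]; exact div_pos (by linarith) (by linarith)
  have hb : 0 < (2 - δ)*((1 + δ + R) / (2*δ)) + δ - 1/δ - (1 - γ) := by
    have e : (2 - δ)*((1 + δ + R) / (2*δ)) + δ - 1/δ - (1 - γ)
        = (((1 + R - δ)/2)^2 + (δ + R - 1)/2) / δ := by
      field_simp
      nlinarith
    rw [e]
    exact div_pos (by nlinarith [sq_nonneg ((1 + R - δ)/2)]) hδ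
  have hn := mul_pos (by linarith : 0 < 3 * Real.sqrt ((1 + δ + R) / (2*δ)) / 2) hb
  exact ⟨div_pos hn (abs_pos.mpr (mul_ne_zero hd.ne' (by linarith : 1 - (1 + δ + R) / (2*δ) < 0).ne)),
    div_pos hn (mul_pos hd hp)⟩
end

section
/- For every γ ∈ (0,1) and δ > 0, the dispersion coefficients of the KdV approximation are positive: μ₊ = (c₊/6)·[(1+3γ/δ+1/δ²)(c₊² − (1−γ)/(δ+1)) − c₊²/δ] / (c₊² − 2(1−γ)/(δ+1)) > 0 and μ₋ = (c₋/6)·[(1+3γ/δ+1/δ²)(c₋² − (1−γ)/(δ+1)) − c₋²/δ] / (c₋² − 2(1−γ)/(δ+1)) > 0. In particular the KdV approximation never degenerates into Burgers-type equations. -/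
/-- The dispersion coefficient `μ_±` of the KdV approximation, evaluated at a wave
speed `cpm ∈ {c₊, c₋}`. -/
noncomputable def muCoef (γ δ cpm : ℝ) : ℝ :=
  (cpm/6) * ((1 + 3*γ/δ + 1/δ^2) * (cpm^2 - (1 - γ)/(δ + 1)) - cpm^2/δ) /
    (cpm^2 - 2*(1 - γ)/(δ + 1))

theorem muCoef_pos_aux (γ δ c : ℝ) (hδ : 0 < δ) (hc : 0 < c)
    (hq : γ = 1 - (1 + δ) * c^2 + δ * (c^2)^2)
    (h : 0 < ((δ^2 + 3*γ*δ + 1) * c^2 - (1 + δ)) / (2*δ*c^2 - (1 + δ))) :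
    0 < muCoef γ δ c := by
  have hx : 0 < c^2 := by positivity
  have h1 : (1 + 3*γ/δ + 1/δ^2) * (c^2 - (1 - γ)/(δ + 1)) - c^2/δ
      = c^2 / (δ * (δ + 1)) * ((δ^2 + 3*γ*δ + 1) * c^2 - (1 + δ)) := by
    have : c^2 - (1 - γ)/(δ + 1) = δ * (c^2)^2 / (δ + 1) := by
      field_simp
      rw [hq]; ring
    rw [this]
    field_simp
    ring
  have h2 : c^2 - 2*(1 - γ)/(δ + 1) = c^2 / (δ + 1) * (2*δ*c^2 - (1 + δ)) := by
    field_simp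
    rw [hq]; ring
  have h3 : muCoef γ δ c = c / (6 * δ) *
      (((δ^2 + 3*γ*δ + 1) * c^2 - (1 + δ)) / (2*δ*c^2 - (1 + δ))) := by
    have hne : 2*δ*c^2 - (1 + δ) ≠ 0 := by
      intro h0
      rw [h0] at h
      simp at h
    unfold muCoef
    rw [h1, h2]
    generalize 2*δ*c^2 - (1 + δ) = B at *
    generalize (δ^2 + 3*γ*δ + 1) * c^2 - (1 + δ) = A at *
    field_simp
  rw [h3]
  positivity

/-- For every `γ ∈ (0,1)` and `δ > 0`, the dispersion coefficients of the KdV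
approximation are positive: `μ₊ > 0` and `μ₋ > 0`. In particular the KdV approximation
never degenerates into Burgers-type equations. -/
theorem dispersion_coefficients_pos (γ δ : ℝ) (hγ : γ ∈ Set.Ioo (0:ℝ) 1) (hδ : 0 < δ) :
    0 < muCoef γ δ (cPlus γ δ) ∧ 0 < muCoef γ δ (cMinus γ δ) := by
  obtain ⟨h0, h1⟩ := hγ
  have hD : 0 < (1 - δ)^2 + 4*γ*δ := by positivity
  have hr : 0 < Real.sqrt ((1 - δ)^2 + 4*γ*δ) := Real.sqrt_pos.2 hD
  have hr2 := Real.sq_sqrt hD.le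
  unfold cPlus cMinus
  generalize Real.sqrt ((1 - δ)^2 + 4*γ*δ) = r at *
  have hr1 : r < 1 + δ := by
    apply lt_of_pow_lt_pow_left₀ 2 (by positivity)
    nlinarith [mul_pos hδ (sub_pos.2 h1)]
  have hK : 0 < δ^2 + 3*γ*δ + 1 := by positivity
  have key : |(2*δ - (δ^2 + 3*γ*δ + 1)) * (1 + δ)| < (δ^2 + 3*γ*δ + 1) * r := by
    apply abs_lt_of_sq_lt_sq _ (by positivity)
    rw [mul_pow _ r, hr2]
    have e : 0 < 4 * δ * (γ*((1-δ)^2)^2 + 4*γ*δ*(1-δ)^2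
        + (1-δ)^2*δ*(1 - 3*γ + 6*γ^2) + δ^2*(4*γ + 3*γ^2 + 9*γ^3)) := by
      have : 0 < 1 - 3*γ + 6*γ^2 := by nlinarith [sq_nonneg (4*γ - 1)]
      positivity
    linear_combination e
  obtain ⟨k1, k2⟩ := abs_lt.1 key
  have hγe : γ = (r^2 - (1 - δ)^2) / (4*δ) := by
    rw [hr2]; field_simp; ring
  constructor
  · have hp : 0 < (1 + δ + r) / (2*δ) := by positivity
    have hs := Real.sq_sqrt hp.le
    apply muCoef_pos_aux _ _ _ hδ (Real.sqrt_pos.2 hp)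
    · rw [hs, hγe]; field_simp; ring
    · rw [hs]
      apply div_pos
      · rw [← mul_div_assoc, sub_pos, lt_div_iff₀ (by positivity)]
        linarith
      · rw [mul_div_cancel₀ _ (by positivity)]; linarith
  · have hp : 0 < (1 + δ - r) / (2*δ) := div_pos (by linarith) (by positivity)
    have hs := Real.sq_sqrt hp.le
    apply muCoef_pos_aux _ _ _ hδ (Real.sqrt_pos.2 hp)
    · rw [hs, hγe]; field_simp; ring
    · rw [hs]
      apply div_pos_of_neg_of_neg
      · rw [← mul_div_assoc, sub_neg, div_lt_iff₀ (by positivity)]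
        linarith
      · rw [mul_div_cancel₀ _ (by positivity)]; linarith
end

section
/- Let N ≥ 1 be an integer, dt, dx > 0 and c, λ, μ real parameters. For a vector w ∈ ℝ^(ℤ/Nℤ), define (D₁w)ᵢ = (w_{i+1} − w_{i−1})/(2dx) and (D₃w)ᵢ = (w_{i+2} − 2w_{i+1} + 2w_{i−1} − w_{i−2})/(2dx³), indices taken modulo N. Suppose u, U, w ∈ ℝ^(ℤ/Nℤ) (representing uⁿ, uⁿ⁺¹ and the predictor uⁿ⁺¹ᐟ²) satisfy, for every i, (Uᵢ − uᵢ)/dt + c·(D₁v)ᵢ + (λ/3)·[ ((U_{i+1} + u_{i+1} + U_{i−1} + u_{i−1})/4)·(ized₁w)ᵢ + (wᵢ + (w_{i+1}+w_{i−1})/2)·(D₁v)ᵢ ] + μ·(D₃v)ᵢ = 0, where v = (U + u)/2 and (D₁w)ᵢ is the centered difference of w. Then the discrete L² norm is conserved: Σᵢ Uᵢ² = Σᵢ uᵢ². -/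
/-- The Crank–Nicholson scheme with predictive step for the generic KdV equation
`∂ₜu + c∂ₓu + λu∂ₓu + μ∂ₓ³u = 0` on a periodic grid of `N ≥ 1` points conserves the
discrete `L²` norm: if `u`, `U`, `w` (representing `uⁿ`, `uⁿ⁺¹` and the predictor
`uⁿ⁺¹ᐟ²`) satisfy the scheme, then `Σᵢ Uᵢ² = Σᵢ uᵢ²`. -/
theorem kdv_scheme_conserves_L2 (N : ℕ) [NeZero N] (hN : 1 ≤ N)
    (dt dx c lam μ : ℝ) (hdt : 0 < dt) (hdx : 0 < dx)
    (u U w : ZMod N → ℝ)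
    (D₁ D₃ : (ZMod N → ℝ) → ZMod N → ℝ)
    (hD₁ : ∀ (v : ZMod N → ℝ) (i : ZMod N), D₁ v i = (v (i+1) - v (i-1)) / (2*dx))
    (hD₃ : ∀ (v : ZMod N → ℝ) (i : ZMod N),
      D₃ v i = (v (i+2) - 2*v (i+1) + 2*v (i-1) - v (i-2)) / (2*dx^3))
    (hscheme : ∀ i : ZMod N,
      (U i - u i)/dt
        + c * D₁ (fun j => (U j + u j)/2) i
        + (lam/3) * ( ((U (i+1) + u (i+1) + U (i-1) + u (i-1))/4) * D₁ w i
            + (w i + (w (i+1) + w (i-1))/2) * D₁ (fun j => (U j + u j)/2) i )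
        + μ * D₃ (fun j => (U j + u j)/2) i = 0) :
    ∑ i : ZMod N, (U i)^2 = ∑ i : ZMod N, (u i)^2 := by
  have shift : ∀ (F : ZMod N → ℝ) (k : ZMod N), ∑ i, (F i - F (i - k)) = 0 := by
    intro F k
    rw [Finset.sum_sub_distrib, sub_eq_zero]
    exact (Equiv.sum_comp (Equiv.subRight k) F).symm
  obtain ⟨v, hv⟩ : ∃ v : ZMod N → ℝ, v = fun j => (U j + u j)/2 := ⟨_, rfl⟩
  have hv' : ∀ j, U j = 2 * v j - u j := by
    intro j
    rw [hv]
    ring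
  rw [← hv] at hscheme
  have key : ∀ i, (U i)^2 - (u i)^2 =
      (-2 * dt * c / (2*dx)) * (v i * v (i+1) - v (i-1) * v (i-1+1))
      + (-2 * dt * lam / 3 / (2*dx)) * (v i * v (i+1) * (w i + w (i+1))
          - v (i-1) * v (i-1+1) * (w (i-1) + w (i-1+1)))
      + (-2 * dt * μ / (2*dx^3)) * ((v i * v (i+2) - v (i-2) * v (i-2+2))
          - 2 * (v i * v (i+1) - v (i-1) * v (i-1+1))) := by
    intro i
    have h := hscheme i
    rw [hD₁, hD₁, hD₃] at h
    simp only [sub_add_cancel]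
    rw [hv' (i+1), hv' (i-1)] at h
    have e : U i ^ 2 - u i ^ 2 = 2 * dt * v i * ((U i - u i)/dt) := by
      rw [hv' i]
      field_simp
      ring
    rw [e]
    linear_combination (2 * dt * v i) * h
  rw [← sub_eq_zero, ← Finset.sum_sub_distrib, Finset.sum_congr rfl (fun i _ => key i)]
  have h1 := shift (fun i => v i * v (i+1)) 1
  have h2 := shift (fun i => v i * v (i+1) * (w i + w (i+1))) 1
  have h3 := shift (fun i => v i * v (i+2)) 2
  rw [Finset.sum_add_distrib, Finset.sum_add_distrib, ← Finset.mul_sum, ← Finset.mul_sum,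
    ← Finset.mul_sum, Finset.sum_sub_distrib (f := fun i => v i * v (i+2) - v (i-2) * v (i-2+2)),
    ← Finset.mul_sum, h1, h2, h3]
  ring
end

section
/- Fix γ ∈ (0,1). As δ → +∞, the fast-mode KdV coefficients converge to those of the classical one-layer KdV equation: c₊(γ,δ) → 1, λˢ₊(γ,δ) → 3/2, and μ₊(γ,δ) → 1/6. -/
open Filter

/-- The fast-mode surface nonlinearity coefficient `λˢ₊`. -/
noncomputable def lambdaSPlus (γ δ : ℝ) : ℝ :=
  (3*cPlus γ δ/2) * ((2 - δ)*(cPlus γ δ)^2 + δ - 1/δ - (1 - γ)) /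
    (((cPlus γ δ)^2 - (cMinus γ δ)^2) * (cPlus γ δ)^2)

/-- The fast-mode dispersion coefficient `μ₊`. -/
noncomputable def muPlus (γ δ : ℝ) : ℝ :=
  (cPlus γ δ/6) *
    ((1 + 3*γ/δ + 1/δ^2) * ((cPlus γ δ)^2 - (1 - γ)/(δ + 1)) - (cPlus γ δ)^2/δ) /
    ((cPlus γ δ)^2 - 2*(1 - γ)/(δ + 1))

noncomputable def auxS (γ t : ℝ) : ℝ := Real.sqrt ((t - 1)^2 + 4*γ*t)

noncomputable def auxC (γ t : ℝ) : ℝ := (1 + t + auxS γ t) / 2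

lemma auxS_sq (γ t : ℝ) (hγ : 0 < γ) (ht : 0 < t) : (auxS γ t)^2 = (t - 1)^2 + 4*γ*t :=
  Real.sq_sqrt (by positivity)

lemma sqrt_eq_auxS (γ δ : ℝ) (hδ : 0 < δ) :
    Real.sqrt ((1 - δ)^2 + 4*γ*δ) = δ * auxS γ δ⁻¹ := by
  have : (1 - δ)^2 + 4*γ*δ = δ^2 * ((δ⁻¹ - 1)^2 + 4*γ*δ⁻¹) := by
    field_simp
  rw [this, Real.sqrt_mul (by positivity), Real.sqrt_sq hδ.le, auxS]

lemma cPlus_eq (γ δ : ℝ) (hδ : 0 < δ) : cPlus γ δ = Real.sqrt (auxC γ δ⁻¹) := by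
  rw [cPlus, sqrt_eq_auxS γ δ hδ, auxC]
  congr 1
  field_simp
  ring

lemma auxC_pos (γ t : ℝ) (ht : 0 < t) : 0 < auxC γ t := by
  have : 0 ≤ auxS γ t := Real.sqrt_nonneg _
  unfold auxC
  positivity

lemma cPlus_sq (γ δ : ℝ) (hδ : 0 < δ) : (cPlus γ δ)^2 = auxC γ δ⁻¹ := by
  rw [cPlus_eq γ δ hδ, Real.sq_sqrt (auxC_pos γ _ (by positivity)).le]

lemma cMinus_sq (γ δ : ℝ) (hγ : γ < 1) (hδ : 0 < δ) :
    (cMinus γ δ)^2 = (1 + δ⁻¹ - auxS γ δ⁻¹) / 2 := by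
  have h : Real.sqrt ((1 - δ)^2 + 4*γ*δ) ≤ 1 + δ := by
    apply Real.sqrt_le_iff.2
    constructor
    · positivity
    · nlinarith
  rw [cMinus, Real.sq_sqrt (div_nonneg (by linarith) (by positivity)), sqrt_eq_auxS γ δ hδ]
  field_simp
  ring

lemma key (γ δ : ℝ) (hγ : 0 < γ) (hδ : 0 < δ) :
    δ * (auxC γ δ⁻¹ - 1) = (1 + (δ⁻¹ - 2 + 4*γ) / (auxS γ δ⁻¹ + 1)) / 2 := by
  have h := auxS_sq γ δ⁻¹ hγ (by positivity)
  have hS : 0 ≤ auxS γ δ⁻¹ := Real.sqrt_nonneg _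
  unfold auxC
  generalize auxS γ δ⁻¹ = S at *
  have hS1 : S + 1 ≠ 0 := by positivity
  have hd : δ * δ⁻¹ = 1 := mul_inv_cancel₀ hδ.ne'
  generalize δ⁻¹ = t at *
  field_simp
  linear_combination δ * h + (S + t - 1 + 4 * γ - 1 + 1) * hd

/-- Fix `γ ∈ (0,1)`. As `δ → +∞`, the fast-mode KdV coefficients converge to those of
the classical one-layer KdV equation: `c₊ → 1`, `λˢ₊ → 3/2`, and `μ₊ → 1/6`. -/
theorem fast_mode_one_layer_limit (γ : ℝ) (hγ : γ ∈ Set.Ioo (0:ℝ) 1) :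
    Tendsto (fun δ => cPlus γ δ) atTop (nhds 1) ∧
    Tendsto (fun δ => lambdaSPlus γ δ) atTop (nhds (3/2)) ∧
    Tendsto (fun δ => muPlus γ δ) atTop (nhds (1/6)) := by
  obtain ⟨h0, h1⟩ := hγ
  have ht : Tendsto (fun δ : ℝ => δ⁻¹) atTop (nhds 0) := tendsto_inv_atTop_zero
  have hS : Tendsto (fun δ : ℝ => auxS γ δ⁻¹) atTop (nhds 1) := by
    have hc : Continuous (auxS γ) := by unfold auxS; fun_prop
    have := (hc.tendsto 0).comp ht
    simpa [auxS, Function.comp_def] using this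
  have hC : Tendsto (fun δ : ℝ => auxC γ δ⁻¹) atTop (nhds 1) := by
    have := ((ht.const_add 1).add hS).div_const 2
    norm_num at this
    exact this
  have hpos : ∀ᶠ δ : ℝ in atTop, 0 < δ := eventually_gt_atTop 0
  have hc : Tendsto (fun δ => cPlus γ δ) atTop (nhds 1) := by
    have := hC.sqrt
    rw [Real.sqrt_one] at this
    refine this.congr' ?_
    filter_upwards [hpos] with δ hδ
    rw [cPlus_eq γ δ hδ]
  refine ⟨hc, ?_, ?_⟩
  · have hK : Tendsto (fun δ : ℝ => (1 + (δ⁻¹ - 2 + 4*γ) / (auxS γ δ⁻¹ + 1)) / 2) atTop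
        (nhds ((1 + (0 - 2 + 4*γ) / (1 + 1)) / 2)) :=
      ((((ht.sub_const 2).add_const (4*γ)).div (hS.add_const 1) (by norm_num)).const_add 1).div_const 2
    have hF := (((hc.const_mul 3).div_const 2).mul
      ((((hC.const_mul 2).sub hK).sub ht).sub_const (1 - γ))).div (hS.mul hC) (by norm_num)
    have e : 3 * 1 / 2 * (2 * 1 - (1 + (0 - 2 + 4*γ) / (1 + 1)) / 2 - 0 - (1 - γ)) / (1 * 1)
        = 3 / 2 := by ring
    rw [e] at hF
    refine hF.congr' ?_
    filter_upwards [hpos] with δ hδ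
    have e1 := key γ δ h0 hδ
    simp only [Pi.div_apply, lambdaSPlus]
    rw [cPlus_sq γ δ hδ, cMinus_sq γ δ h1 hδ, ← e1]
    congr 1
    · ring
    · unfold auxC; ring
  · have hi : Tendsto (fun δ : ℝ => (δ + 1)⁻¹) atTop (nhds 0) :=
      tendsto_inv_atTop_zero.comp (tendsto_atTop_add_const_right _ 1 tendsto_id)
    have hF := ((hc.div_const 6).mul
      (((((ht.const_mul (3*γ)).const_add 1).add (ht.pow 2)).mul
        (hC.sub (hi.const_mul (1 - γ)))).sub (hC.mul ht))).div
      (hC.sub (hi.const_mul (2*(1 - γ)))) (by norm_num)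
    have e : 1 / 6 * ((1 + 3*γ*0 + 0^2) * (1 - (1 - γ)*0) - 1*0) / (1 - 2*(1-γ)*0)
        = (1 / 6 : ℝ) := by norm_num
    rw [e] at hF
    refine hF.congr' ?_
    filter_upwards [hpos] with δ hδ
    simp only [Pi.div_apply, muPlus]
    rw [cPlus_sq γ δ hδ]
    simp only [div_eq_mul_inv, inv_pow, one_mul]
end
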